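/- arXiv:2107.04884 — 2 statements merged into one kernel-verified Lean document; each statement's English description precedes it below -/
import Mathlib

section
/- Let n ≥ 3 and let u₁ : ℝⁿ → ℝ be continuous and nonnegative. Suppose u : ℝⁿ → ℝ is a nonnegative C² function satisfying −Δu = u₁ in ℝⁿ. Then for all x ∈ ℝⁿ, c_n ∫_{ℝⁿ} u₁(y)/|x−y|^{n−2} dy ≤ u(x), where c_n = 1/(n(n−2)v_n) and v_n is the volume of the unit ball in ℝⁿ. In particular the Newtonian potential of u₁ is finite at every point. -/
open MeasureTheory Metric

/-- The Laplacian of a function on `ℝⁿ`, as the sum of pure second derivatives. -/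
noncomputable def lap {n : ℕ} (u : EuclideanSpace ℝ (Fin n) → ℝ)
    (x : EuclideanSpace ℝ (Fin n)) : ℝ :=
  ∑ i : Fin n, iteratedFDeriv ℝ 2 u x ![EuclideanSpace.single i 1, EuclideanSpace.single i 1]


open Set Filter Topology

/-- convex cut-off -/
lemma exists_cutoff (δ : ℝ) (hδ : 0 < δ) : ∃ ψ k k' : ℝ → ℝ,
    (∀ t, HasDerivAt ψ (k t) t) ∧ (∀ t, HasDerivAt k (k' t) t) ∧ (Continuous k') ∧
    (∀ t, 0 ≤ k t) ∧ (∀ t, k t ≤ 1) ∧ (∀ t, 0 ≤ k' t) ∧ (∀ t ≤ δ, k t = 0) ∧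
    (∀ t, 0 ≤ t → t ≤ δ → ψ t = 0) ∧ (∀ t, 0 ≤ t → 0 ≤ ψ t) ∧
    (∀ t, 0 ≤ t → t - 2 * δ ≤ ψ t) ∧ (∀ t, 0 ≤ t → ψ t ≤ t) := by
  set k : ℝ → ℝ := fun t => Real.smoothTransition ((t - δ) / δ) with hk
  have hkc : ContDiff ℝ 1 k :=
    (Real.smoothTransition.contDiff (n := 1)).comp (by fun_prop)
  have hkcont : Continuous k := hkc.continuous
  have hmono : Monotone k := by
    intro a b hab
    apply Real.smoothTransition.monotone
    gcongr
  have h0 : ∀ t, 0 ≤ k t := fun t => Real.smoothTransition.nonneg _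
  have h1 : ∀ t, k t ≤ 1 := fun t => Real.smoothTransition.le_one _
  have hz : ∀ t ≤ δ, k t = 0 := fun t ht => Real.smoothTransition.zero_of_nonpos
    (div_nonpos_of_nonpos_of_nonneg (by linarith) hδ.le)
  have hi : ∀ a b, IntervalIntegrable k volume a b := fun a b => hkcont.intervalIntegrable a b
  have hpos : ∀ t, 0 ≤ t → 0 ≤ ∫ s in (0:ℝ)..t, k s := fun t ht =>
    intervalIntegral.integral_nonneg ht (fun s _ => h0 s)
  refine ⟨fun t => ∫ s in (0:ℝ)..t, k s, k, deriv k, ?_, ?_, ?_, h0, h1, ?_, hz, ?_, hpos, ?_, ?_⟩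
  · intro t
    exact intervalIntegral.integral_hasDerivAt_right (hi _ _)
      (hkcont.stronglyMeasurableAtFilter _ _) hkcont.continuousAt
  · intro t
    exact (hkc.differentiable (by norm_num) t).hasDerivAt
  · exact hkc.continuous_deriv (by norm_num)
  · intro t
    exact hmono.deriv_nonneg
  · intro t ht ht'
    have : ∫ s in (0:ℝ)..t, k s = ∫ s in (0:ℝ)..t, (0:ℝ) := by
      apply intervalIntegral.integral_congr
      intro s hs
      rw [uIcc_of_le ht] at hs
      exact hz s (hs.2.trans ht')
    simpa using this
  · intro t ht
    by_cases h : t ≤ 2 * δ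
    · have := hpos t ht
      dsimp only
      linarith
    · push Not at h
      have e : ∫ s in (2 * δ)..t, k s = ∫ s in (2*δ)..t, (1:ℝ) := by
        apply intervalIntegral.integral_congr
        intro s hs
        rw [uIcc_of_le h.le] at hs
        apply Real.smoothTransition.one_of_one_le
        rw [le_div_iff₀ hδ]
        linarith [hs.1]
      have e2 := intervalIntegral.integral_add_adjacent_intervals (hi 0 (2*δ)) (hi (2*δ) t)
      have := hpos (2*δ) (by linarith)
      simp at e
      dsimp only
      linarith
  · intro t ht
    have : ∫ s in (0:ℝ)..t, k s ≤ ∫ s in (0:ℝ)..t, (1:ℝ) :=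
      intervalIntegral.integral_mono_on ht (hi _ _) (by simp) (fun s _ => h1 s)
    simpa using this

lemma lap_eq {n : ℕ} (u : (EuclideanSpace ℝ (Fin n)) → ℝ) (hu : ContDiff ℝ 2 u) (x : EuclideanSpace ℝ (Fin n)) :
    lap u x = ∑ i : Fin n, fderiv ℝ (fun y => fderiv ℝ u y (EuclideanSpace.single i 1)) x
      (EuclideanSpace.single i 1) := by
  unfold lap
  refine Finset.sum_congr rfl fun i _ => ?_
  rw [iteratedFDeriv_two_apply]
  have h1 : ContDiff ℝ 1 (fderiv ℝ u) := hu.fderiv_right (by norm_num)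
  have h2 : DifferentiableAt ℝ (fderiv ℝ u) x := h1.differentiable (by norm_num) x
  rw [fderiv_clm_apply h2 (by fun_prop)]
  simp

lemma green_id {n : ℕ} (u φ : (EuclideanSpace ℝ (Fin n)) → ℝ) (hu : ContDiff ℝ 2 u) (hφ : ContDiff ℝ 2 φ)
    (hc : HasCompactSupport φ) :
    ∫ y, u y * lap φ y = ∫ y, lap u y * φ y := by
  have d1 : ∀ (f : (EuclideanSpace ℝ (Fin n)) → ℝ) (v : EuclideanSpace ℝ (Fin n)), ContDiff ℝ 2 f → ContDiff ℝ 1 (fun y => fderiv ℝ f y v) := by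
    intro f v hf
    exact (hf.fderiv_right (by norm_num)).clm_apply contDiff_const
  have d2 : ∀ (f : (EuclideanSpace ℝ (Fin n)) → ℝ) (v : EuclideanSpace ℝ (Fin n)), ContDiff ℝ 1 f → Continuous (fun y => fderiv ℝ f y v) := by
    intro f v hf
    exact (hf.continuous_fderiv (by norm_num)).clm_apply continuous_const
  have s1 : ∀ (f : (EuclideanSpace ℝ (Fin n)) → ℝ) (v : EuclideanSpace ℝ (Fin n)), HasCompactSupport f →
      HasCompactSupport (fun y => fderiv ℝ f y v) := fun f v hf => hf.fderiv_apply (𝕜 := ℝ) v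
  have key : ∀ (f g : (EuclideanSpace ℝ (Fin n)) → ℝ), Continuous f → Continuous g → HasCompactSupport g →
      Integrable (fun y => f y * g y) := fun f g hf hg hcg =>
    (hf.mul hg).integrable_of_hasCompactSupport hcg.mul_left
  simp_rw [lap_eq u hu, lap_eq φ hφ, Finset.mul_sum, Finset.sum_mul]
  have cu := hu.continuous
  have cφ := hφ.continuous
  rw [integral_finsetSum, integral_finsetSum]
  · refine Finset.sum_congr rfl fun i _ => ?_
    set e : EuclideanSpace ℝ (Fin n) := EuclideanSpace.single i 1
    have a1 := d1 u e hu
    have a2 := d1 φ e hφ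
    have b1 := d2 _ e a1
    have b2 := d2 _ e a2
    have c2 := s1 φ e hc
    have c3 := s1 _ e c2
    rw [integral_mul_fderiv_eq_neg_fderiv_mul_of_integrable
      (key _ _ a1.continuous a2.continuous c2) (key _ _ cu b2 c3) (key _ _ cu a2.continuous c2)
      (fun x _ => hu.differentiable (by norm_num) x) (fun x _ => a2.differentiable (by norm_num) x),
      integral_mul_fderiv_eq_neg_fderiv_mul_of_integrable
      (key _ _ b1 cφ hc) (key _ _ a1.continuous a2.continuous c2) (key _ _ a1.continuous cφ hc)
      (fun x _ => a1.differentiable (by norm_num) x) (fun x _ => hφ.differentiable (by norm_num) x)]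
    simp
  · intro i _
    exact key _ _ (d2 _ _ (d1 u _ hu)) cφ hc
  · intro i _
    exact key _ _ cu (d2 _ _ (d1 φ _ hφ)) (s1 _ _ (s1 _ _ hc))

/-- Laplacian of a radial function. -/
lemma lap_radial {n : ℕ} (x : EuclideanSpace ℝ (Fin n)) (F G G' : ℝ → ℝ)
    (hF : ∀ s, 0 ≤ s → HasDerivAt F (G s) s) (hG : ∀ s, 0 ≤ s → HasDerivAt G (G' s) s)
    (hc : ContDiff ℝ 2 (fun y : EuclideanSpace ℝ (Fin n) => F (‖x - y‖ ^ 2))) (y : EuclideanSpace ℝ (Fin n)) :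
    lap (fun y : EuclideanSpace ℝ (Fin n) => F (‖x - y‖ ^ 2)) y =
      2 * n * G (‖x - y‖ ^ 2) + 4 * ‖x - y‖ ^ 2 * G' (‖x - y‖ ^ 2) := by
  rw [lap_eq _ hc]
  have hs : ∀ z : EuclideanSpace ℝ (Fin n), HasFDerivAt (fun y : EuclideanSpace ℝ (Fin n) => ‖x - y‖ ^ 2)
      (2 • (innerSL ℝ (x - z)).comp (-ContinuousLinearMap.id ℝ (EuclideanSpace ℝ (Fin n)))) z := fun z =>
    ((hasFDerivAt_id z).const_sub x).norm_sq
  have e1 : ∀ (i : Fin n), (fun z => fderiv ℝ (fun y : EuclideanSpace ℝ (Fin n) => F (‖x - y‖ ^ 2)) z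
      (EuclideanSpace.single i 1)) = fun z => (-2) * ((x i - z i) * G (‖x - z‖ ^ 2)) := by
    intro i
    funext z
    have h0 : HasFDerivAt (fun y : EuclideanSpace ℝ (Fin n) => F (‖x - y‖ ^ 2)) _ z :=
      (hF _ (sq_nonneg _)).comp_hasFDerivAt z (hs z)
    rw [h0.fderiv]
    simp [EuclideanSpace.inner_single_right]
    ring
  simp_rw [e1]
  have e2 : ∀ (i : Fin n), fderiv ℝ (fun z : EuclideanSpace ℝ (Fin n) => (-2) * ((x i - z i) * G (‖x - z‖ ^ 2))) y
      (EuclideanSpace.single i 1) = 2 * G (‖x - y‖ ^ 2) + 4 * G' (‖x - y‖ ^ 2) * (x i - y i) ^ 2 := by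
    intro i
    have h1 : HasFDerivAt (fun z : EuclideanSpace ℝ (Fin n) => x i - z i) (-(EuclideanSpace.proj i : (EuclideanSpace ℝ (Fin n)) →L[ℝ] ℝ)) y :=
      ((EuclideanSpace.proj i : (EuclideanSpace ℝ (Fin n)) →L[ℝ] ℝ).hasFDerivAt).const_sub (x i)
    have h2 := (hG _ (sq_nonneg _)).comp_hasFDerivAt y (hs y)
    have h3 := (h1.mul h2).const_mul (-2)
    have h4 : HasFDerivAt (fun z : EuclideanSpace ℝ (Fin n) => (-2) * ((x i - z i) * G (‖x - z‖ ^ 2))) _ y := h3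
    rw [h4.fderiv]
    simp [EuclideanSpace.inner_single_right]
    ring
  simp_rw [e2]
  have e3 : ‖x - y‖ ^ 2 = ∑ i, (x i - y i) ^ 2 := by
    rw [EuclideanSpace.norm_sq_eq]; simp
  rw [Finset.sum_add_distrib, ← Finset.mul_sum, ← Finset.mul_sum, ← e3]
  simp
  ring

lemma mass {n : ℕ} (hn : 3 ≤ n) :
    ∫ z : EuclideanSpace ℝ (Fin n), (1 + ‖z‖ ^ 2) ^ (-((n:ℝ) / 2) - 1) = (volume (ball (0 : EuclideanSpace ℝ (Fin n)) 1)).toReal := by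
  have : Nontrivial (EuclideanSpace ℝ (Fin n)) := by
    apply Module.nontrivial_of_finrank_pos (R := ℝ)
    simp; omega
  have hn0 : (n:ℝ) ≠ 0 := by positivity
  rw [integral_fun_norm_addHaar volume (fun r : ℝ => (1 + r ^ 2) ^ (-((n:ℝ) / 2) - 1))]
  have : ∫ y in Ioi (0:ℝ), y ^ (n - 1) * (1 + y ^ 2) ^ (-((n:ℝ) / 2) - 1) = 1 / n - (0:ℝ) ^ n * (1 + (0:ℝ) ^ 2) ^ (-((n:ℝ) / 2)) / n := by
    apply integral_Ioi_of_hasDerivAt_of_nonneg' (g := fun r : ℝ => r ^ n * (1 + r ^ 2) ^ (-((n:ℝ) / 2)) / n)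
    · intro r hr
      have hp : 0 < 1 + r ^ 2 := by positivity
      have h1 : HasDerivAt (fun r : ℝ => 1 + r ^ 2) (2 * r) r := by
        simpa using (hasDerivAt_pow 2 r).const_add 1
      have h2 := h1.rpow_const (p := -((n:ℝ) / 2)) (Or.inl hp.ne')
      have h3 := ((hasDerivAt_pow n r).mul h2).div_const (n:ℝ)
      refine (h3.congr_deriv ?_)
      have e : (1 + r ^ 2) ^ (-((n:ℝ) / 2)) = (1 + r ^ 2) ^ (-((n:ℝ) / 2) - 1) * (1 + r^2) := by
        rw [← Real.rpow_add_one hp.ne']; ring_nf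
      obtain ⟨m, rfl⟩ : ∃ m, n = m + 1 := ⟨n - 1, by omega⟩
      rw [e]
      simp only [Nat.add_sub_cancel]
      field_simp
      ring
    · intro r hr
      have : (0:ℝ) < r := hr
      positivity
    · have h1 : Tendsto (fun r : ℝ => (((1:ℝ) - (1 + r ^ 2)⁻¹) ^ ((n:ℝ)/2)) / (n:ℝ)) atTop (𝓝 (((1:ℝ) - 0) ^ ((n:ℝ)/2) / (n:ℝ))) := by
        apply Tendsto.div_const
        apply Tendsto.rpow_const
        · apply Tendsto.const_sub
          apply Tendsto.inv_tendsto_atTop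
          exact tendsto_atTop_add_const_left _ _ (tendsto_pow_atTop (by norm_num))
        · left; norm_num
      simp only [sub_zero, Real.one_rpow] at h1
      refine h1.congr' ?_
      filter_upwards [eventually_gt_atTop 0] with r hr
      have hp : 0 < 1 + r ^ 2 := by positivity
      have : 1 - (1 + r ^ 2)⁻¹ = r ^ 2 / (1 + r ^ 2) := by field_simp; ring
      rw [this, Real.div_rpow (by positivity) hp.le, Real.rpow_neg hp.le, ← Real.rpow_natCast r 2,
        ← Real.rpow_mul hr.le]
      norm_num
      rw [mul_div_cancel₀ _ (by norm_num), Real.rpow_natCast]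
      rfl
  simp only [finrank_euclideanSpace, Fintype.card_fin, smul_eq_mul, nsmul_eq_mul]
  rw [this, zero_pow (by omega)]
  simp [Measure.real]
  field_simp

lemma contDiff_two_of {ψ k k' : ℝ → ℝ} (h1 : ∀ t, HasDerivAt ψ (k t) t)
    (h2 : ∀ t, HasDerivAt k (k' t) t) (h3 : Continuous k') : ContDiff ℝ 2 ψ := by
  have e1 : deriv ψ = k := funext fun t => (h1 t).deriv
  have e2 : deriv k = k' := funext fun t => (h2 t).deriv
  have hk : ContDiff ℝ 1 k := contDiff_one_iff_deriv.2
    ⟨fun t => (h2 t).differentiableAt, by rw [e2]; exact h3⟩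
  rw [show (2 : WithTop ℕ∞) = 1 + 1 from by norm_num, contDiff_succ_iff_deriv]
  refine ⟨fun t => (h1 t).differentiableAt, ?_, by rw [e1]; exact hk⟩
  intro h
  exact absurd h (by simp)

lemma hasDerivAt_shift_rpow {a s q : ℝ} (h : 0 < s + a) :
    HasDerivAt (fun s : ℝ => (s + a) ^ q) (q * (s + a) ^ (q - 1)) s := by
  have h1 : HasDerivAt (fun s : ℝ => s + a) 1 s := (hasDerivAt_id s).add_const a
  have := h1.rpow_const (p := q) (Or.inl h.ne')
  simpa using this

lemma contDiff_phi {n : ℕ} (x : EuclideanSpace ℝ (Fin n)) {ψ : ℝ → ℝ} (hψ : ContDiff ℝ 2 ψ)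
    {a p : ℝ} (ha : 0 < a) :
    ContDiff ℝ 2 (fun y : EuclideanSpace ℝ (Fin n) => ψ ((‖x - y‖ ^ 2 + a) ^ p)) := by
  apply hψ.comp
  apply ContDiff.rpow_const_of_ne
  · exact ((contDiff_const.sub contDiff_id).norm_sq ℝ).add contDiff_const
  · intro y
    positivity

lemma lap_bound {n : ℕ} (x : EuclideanSpace ℝ (Fin n)) {ψ k k' : ℝ → ℝ}
    (h1 : ∀ t, HasDerivAt ψ (k t) t)
    (h2 : ∀ t, HasDerivAt k (k' t) t) (h3 : Continuous k') (h4 : ∀ t, 0 ≤ k' t)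
    {a : ℝ} (ha : 0 < a) (y : EuclideanSpace ℝ (Fin n)) :
    -lap (fun y : EuclideanSpace ℝ (Fin n) => ψ ((‖x - y‖ ^ 2 + a) ^ (-((n:ℝ)/2 - 1)))) y ≤
      k ((‖x - y‖ ^ 2 + a) ^ (-((n:ℝ)/2 - 1))) *
        (n * (n - 2) * (a * (‖x - y‖ ^ 2 + a) ^ (-((n:ℝ)/2) - 1))) := by
  obtain ⟨p, hp⟩ : ∃ p : ℝ, p = (n:ℝ)/2 - 1 := ⟨_, rfl⟩
  have hnp : (n:ℝ) = 2 * p + 2 := by rw [hp]; ring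
  rw [← hp, show -((n:ℝ)/2) - 1 = -p - 2 by rw [hp]; ring]
  have hc := contDiff_phi (p := -p) x (contDiff_two_of h1 h2 h3) ha
  rw [lap_radial x (fun s => ψ ((s + a) ^ (-p)))
    (fun s => k ((s + a) ^ (-p)) * (-p * (s + a) ^ (-p - 1)))
    (fun s => k' ((s + a) ^ (-p)) * (-p * (s + a) ^ (-p - 1)) * (-p * (s + a) ^ (-p - 1))
      + k ((s + a) ^ (-p)) * (-p * ((-p - 1) * (s + a) ^ (-p - 1 - 1)))) ?_ ?_ hc y]
  · generalize hs : ‖x - y‖ ^ 2 = s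
    have hs0 : 0 ≤ s := by rw [← hs]; positivity
    have hsa : 0 < s + a := by positivity
    have eA : (s + a) ^ (-p - 1) = (s + a) ^ (-p - 2) * (s + a) := by
      rw [← Real.rpow_add_one hsa.ne']; ring_nf
    have eB : -p - 1 - 1 = -p - 2 := by ring
    rw [eB, eA, hnp]
    generalize (s + a) ^ (-p - 2) = A
    have hk' := h4 ((s + a) ^ (-p))
    generalize k' ((s + a) ^ (-p)) = K' at *
    generalize k ((s + a) ^ (-p)) = K at *
    have : 0 ≤ 4 * s * (K' * (p * (A * (s + a))) ^ 2) := by positivity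
    linarith
  · intro s hs
    exact (h1 _).comp s (hasDerivAt_shift_rpow (by positivity))
  · intro s hs
    have d1 := (h2 ((s + a) ^ (-p))).comp s (hasDerivAt_shift_rpow (q := -p) (s := s) (a := a) (by positivity))
    have d2 := (hasDerivAt_shift_rpow (q := -p - 1) (s := s) (a := a) (by positivity)).const_mul (-p)
    exact d1.mul d2

lemma peak {n : ℕ} (hn : 3 ≤ n) (x : EuclideanSpace ℝ (Fin n)) (u : EuclideanSpace ℝ (Fin n) → ℝ)
    (hu : Continuous u) {vn : ℝ} (hv : 0 < vn)
    (hvn : vn = (volume (ball (0 : EuclideanSpace ℝ (Fin n)) 1)).toReal) {R : ℝ} (hR : 0 < R) :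
    Tendsto (fun c : ℝ => ∫ y, ((c⁻¹) ^ 2 * (‖x - y‖ ^ 2 + (c⁻¹) ^ 2) ^ (-((n:ℝ)/2) - 1))
      * (ball x R).indicator u y) atTop (𝓝 (vn * u x)) := by
  have key := tendsto_integral_comp_smul_smul_of_integrable' (μ := (volume : Measure (EuclideanSpace ℝ (Fin n))))
    (φ := fun z => (1 + ‖z‖ ^ 2) ^ (-((n:ℝ) / 2) - 1) / vn) (fun z => by positivity)
    (by rw [integral_div, mass hn, ← hvn, div_self hv.ne']) ?_
    (g := (ball x R).indicator u) (x₀ := x) ?_ ?_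
  · have k2 := key.const_mul vn
    rw [indicator_of_mem (mem_ball_self hR)] at k2
    refine k2.congr' ?_
    filter_upwards [eventually_gt_atTop 0] with c hc
    rw [← integral_const_mul]
    refine integral_congr_ae (Eventually.of_forall fun y => ?_)
    simp only [finrank_euclideanSpace, Fintype.card_fin, smul_eq_mul]
    have e1 : 1 + ‖c • (x - y)‖ ^ 2 = c ^ 2 * (‖x - y‖ ^ 2 + c⁻¹ ^ 2) := by
      rw [norm_smul, Real.norm_of_nonneg hc.le]; field_simp; ring
    have e2 : (c ^ 2) ^ (-((n:ℝ) / 2) - 1) = (c ^ n)⁻¹ * c⁻¹ ^ 2 := by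
      rw [← Real.rpow_natCast c 2, ← Real.rpow_mul hc.le, ← Real.rpow_natCast c n, ← Real.rpow_neg hc.le,
        inv_pow, ← Real.rpow_natCast c 2, ← Real.rpow_neg hc.le, ← Real.rpow_add hc]
      congr 1; push_cast; ring
    rw [e1, Real.mul_rpow (by positivity) (by positivity), e2]
    field_simp
  · simp only [finrank_euclideanSpace, Fintype.card_fin]
    have t : Tendsto (fun z : EuclideanSpace ℝ (Fin n) => (1 + ‖z‖ ^ 2)⁻¹ / vn)
        (Bornology.cobounded _) (𝓝 (0 / vn)) := by
      apply Tendsto.div_const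
      apply Tendsto.inv_tendsto_atTop
      exact tendsto_atTop_add_const_left _ _
        ((tendsto_pow_atTop (by norm_num)).comp tendsto_norm_cobounded_atTop)
    rw [zero_div] at t
    refine squeeze_zero (fun z => by positivity) (fun z => ?_) t
    rw [← mul_div_assoc]
    gcongr
    have hp : 0 < 1 + ‖z‖ ^ 2 := by positivity
    rw [Real.rpow_sub_one hp.ne', Real.rpow_neg hp.le, div_eq_mul_inv, ← mul_assoc]
    have : ‖z‖ ^ n ≤ (1 + ‖z‖ ^ 2) ^ ((n:ℝ)/2) := by
      calc ‖z‖ ^ n = (‖z‖ ^ 2) ^ ((n:ℝ)/2) := by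
            rw [← Real.rpow_natCast _ 2, ← Real.rpow_mul (norm_nonneg _), ← Real.rpow_natCast]
            congr 1; push_cast; ring
        _ ≤ _ := by
            apply Real.rpow_le_rpow (by positivity) (by linarith) (by positivity)
    have h2 : ‖z‖ ^ n * ((1 + ‖z‖ ^ 2) ^ ((n:ℝ)/2))⁻¹ ≤ 1 := by
      rw [← div_eq_mul_inv]
      exact div_le_one_of_le₀ this (by positivity)
    exact mul_le_of_le_one_left (by positivity) h2
  · rw [integrable_indicator_iff measurableSet_ball]
    exact (hu.continuousOn.integrableOn_compact (isCompact_closedBall x R)).mono_set ball_subset_closedBall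
  · exact hu.continuousAt.congr ((eqOn_indicator.symm).eventuallyEq_of_mem (ball_mem_nhds x hR))

lemma step {n : ℕ} (hn : 3 ≤ n)
    (u u₁ : EuclideanSpace ℝ (Fin n) → ℝ)
    (hu : ContDiff ℝ 2 u) (hupos : ∀ x, 0 ≤ u x)
    (hu₁cont : Continuous u₁) (hu₁pos : ∀ x, 0 ≤ u₁ x)
    (heq : ∀ x, -(lap u x) = u₁ x)
    (vn : ℝ) (hvn : vn = (volume (ball (0 : EuclideanSpace ℝ (Fin n)) 1)).toReal) (hv : 0 < vn)
    (x : EuclideanSpace ℝ (Fin n)) (δ : ℝ) (hδ : 0 < δ) :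
    ∃ (a : ℝ) (φ : EuclideanSpace ℝ (Fin n) → ℝ), 0 < a ∧ a < δ ∧ Continuous φ ∧ (∀ y, 0 ≤ φ y) ∧
      (∀ y, (‖x - y‖ ^ 2 + a) ^ (-((n:ℝ)/2 - 1)) - 2 * δ ≤ φ y) ∧
      (∀ y, φ y ≤ (‖x - y‖ ^ 2 + a) ^ (-((n:ℝ)/2 - 1))) ∧
      ∫⁻ y, ENNReal.ofReal (u₁ y * φ y) ≤ ENNReal.ofReal (n * (n - 2) * (vn * u x + δ)) := by
  have hn3 : (3:ℝ) ≤ n := by exact_mod_cast hn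
  obtain ⟨ψ, k, k', h1, h2, h3, k0, k1, h4, kz, ψz, ψ0, ψl, ψu⟩ := exists_cutoff δ hδ
  obtain ⟨p, hp⟩ : ∃ p : ℝ, p = (n:ℝ)/2 - 1 := ⟨_, rfl⟩
  have hp0 : 0 < p := by rw [hp]; linarith
  obtain ⟨R, hR0, hR⟩ : ∃ R : ℝ, 0 < R ∧ (R ^ 2) ^ (-p) ≤ δ := by
    have t : Tendsto (fun R : ℝ => (R ^ 2) ^ (-p)) atTop (𝓝 0) :=
      (tendsto_rpow_neg_atTop hp0).comp (tendsto_pow_atTop (by norm_num))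
    obtain ⟨R, h⟩ := ((eventually_gt_atTop 0).and (t.eventually (eventually_le_nhds hδ))).exists
    exact ⟨R, h⟩
  have pk := peak hn x u hu.continuous hv hvn hR0
  have t2 : Tendsto (fun c : ℝ => (c⁻¹) ^ 2) atTop (𝓝 0) := by
    simpa using (tendsto_inv_atTop_zero (𝕜 := ℝ)).pow 2
  obtain ⟨c, hc, hcδ, hI⟩ := ((eventually_gt_atTop 0).and ((t2.eventually (gt_mem_nhds hδ)).and
    (pk.eventually (eventually_le_nhds (show vn * u x < vn * u x + δ by linarith))))).exists
  set a := c⁻¹ ^ 2 with ha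
  have ha0 : 0 < a := by positivity
  set φ : EuclideanSpace ℝ (Fin n) → ℝ := fun y => ψ ((‖x - y‖ ^ 2 + a) ^ (-((n:ℝ)/2 - 1))) with hφ
  have cd : ContDiff ℝ 2 φ := contDiff_phi x (contDiff_two_of h1 h2 h3) ha0
  have w0 : ∀ y : EuclideanSpace ℝ (Fin n), 0 ≤ (‖x - y‖ ^ 2 + a) ^ (-((n:ℝ)/2 - 1)) :=
    fun y => by positivity
  have φ0 : ∀ y, 0 ≤ φ y := fun y => ψ0 _ (w0 y)
  have wle : ∀ y, y ∉ ball x R → (‖x - y‖ ^ 2 + a) ^ (-((n:ℝ)/2 - 1)) ≤ δ := by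
    intro y hy
    rw [mem_ball', not_lt, dist_eq_norm] at hy
    refine le_trans ?_ hR
    rw [← hp]
    apply Real.rpow_le_rpow_of_nonpos (by positivity) _ (by linarith)
    nlinarith
  have hcs : HasCompactSupport φ := by
    apply HasCompactSupport.intro (isCompact_closedBall x R)
    intro y hy
    exact ψz _ (w0 y) (wle y fun h => hy (ball_subset_closedBall h))
  refine ⟨a, φ, ha0, hcδ, cd.continuous, φ0, fun y => ψl _ (w0 y), fun y => ψu _ (w0 y), ?_⟩
  have int1 : Integrable (fun y => u₁ y * φ y) :=
    (hu₁cont.mul cd.continuous).integrable_of_hasCompactSupport hcs.mul_left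
  rw [← ofReal_integral_eq_lintegral_ofReal int1
    (Eventually.of_forall fun y => mul_nonneg (hu₁pos y) (φ0 y))]
  apply ENNReal.ofReal_le_ofReal
  have e1 : ∫ y, u₁ y * φ y = ∫ y, u y * (-lap φ y) := by
    have := green_id u φ hu cd hcs
    simp_rw [← heq, mul_neg, neg_mul, integral_neg]
    rw [this]
  rw [e1]
  have hnn : (0:ℝ) ≤ n * (n - 2) := mul_nonneg (by linarith) (by linarith)
  calc ∫ y, u y * (-lap φ y) ≤ ∫ y, (n * (n - 2)) * ((a * (‖x - y‖ ^ 2 + a) ^ (-((n:ℝ)/2) - 1))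
      * (ball x R).indicator u y) := by
        have r0 : ∀ y, 0 ≤ (n * (n - 2)) * ((a * (‖x - y‖ ^ 2 + a) ^ (-((n:ℝ)/2) - 1))
            * (ball x R).indicator u y) := by
          intro y
          have := indicator_nonneg (s := ball x R) (fun z _ => hupos z) y
          positivity
        have rint : Integrable (fun y => (n * (n - 2)) * ((a * (‖x - y‖ ^ 2 + a) ^ (-((n:ℝ)/2) - 1))
            * (ball x R).indicator u y)) := by
          have ce : Continuous (fun y => (n * (n - 2)) *
              ((a * (‖x - y‖ ^ 2 + a) ^ (-((n:ℝ)/2) - 1)) * u y)) := by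
            have := hu.continuous
            have c2 : Continuous (fun y => (‖x - y‖ ^ 2 + a) ^ (-((n:ℝ)/2) - 1)) :=
              Continuous.rpow_const (by fun_prop) (fun y => Or.inl (by positivity))
            fun_prop
          have i2 := (integrable_indicator_iff (μ := volume) (measurableSet_ball (x := x) (ε := R))).2
            ((ce.continuousOn.integrableOn_compact (isCompact_closedBall x R)).mono_set
            ball_subset_closedBall)
          refine i2.congr (Eventually.of_forall fun y => ?_)
          by_cases hy : y ∈ ball x R <;> simp [hy, -mem_ball]
        by_cases hint : Integrable (fun y => u y * (-lap φ y))
        · refine integral_mono hint rint fun y => ?_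
          have lb := lap_bound x h1 h2 h3 h4 ha0 y
          dsimp only
          by_cases hy : y ∈ ball x R
          · rw [indicator_of_mem hy]
            have q : 0 ≤ n * (n - 2) * (a * (‖x - y‖ ^ 2 + a) ^ (-((n:ℝ)/2) - 1)) := by positivity
            have := mul_le_mul_of_nonneg_left (lb.trans (mul_le_of_le_one_left q (k1 _))) (hupos y)
            linarith
          · rw [kz _ (wle y hy), zero_mul] at lb
            exact (mul_nonpos_of_nonneg_of_nonpos (hupos y) lb).trans (r0 y)
        · rw [integral_undef hint]
          exact integral_nonneg r0
    _ ≤ _ := by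
        rw [integral_const_mul]
        gcongr

/-- if `u ≥ 0` is `C²` with `−Δu = u₁ ≥ 0` continuous, then the Newtonian
potential of `u₁` is dominated by `u` (in particular it is finite at every point):
`c_n ∫ u₁(y)/|x−y|^{n−2} dy ≤ u(x)` with `c_n = 1/(n(n−2)v_n)`. -/
theorem newtonian_potential_le {n : ℕ} (hn : 3 ≤ n)
    (u u₁ : EuclideanSpace ℝ (Fin n) → ℝ)
    (hu : ContDiff ℝ 2 u) (hupos : ∀ x, 0 ≤ u x)
    (hu₁cont : Continuous u₁) (hu₁pos : ∀ x, 0 ≤ u₁ x)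
    (heq : ∀ x, -(lap u x) = u₁ x)
    (vn : ℝ) (hvn : vn = (volume (ball (0 : EuclideanSpace ℝ (Fin n)) 1)).toReal) :
    ∀ x, ENNReal.ofReal (1 / (n * (n - 2) * vn)) *
        ∫⁻ y, ENNReal.ofReal (u₁ y / ‖x - y‖ ^ ((n : ℝ) - 2)) ∂volume
      ≤ ENNReal.ofReal (u x) := by
  intro x
  have hn3 : (3:ℝ) ≤ n := by exact_mod_cast hn
  have hv : 0 < vn := by
    rw [hvn]
    exact ENNReal.toReal_pos (measure_ball_pos _ _ one_pos).ne' measure_ball_lt_top.ne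
  have hC : (0:ℝ) < n * (n - 2) := mul_pos (by linarith) (by linarith)
  have hδ : ∀ m : ℕ, 0 < 1 / ((m:ℝ) + 1) := fun m => by positivity
  have tδ : Tendsto (fun m : ℕ => 1 / ((m:ℝ) + 1)) atTop (𝓝 0) :=
    tendsto_one_div_add_atTop_nhds_zero_nat
  choose a φ ha0 haδ φc φ0 φl φu φI using fun m : ℕ =>
    step hn u u₁ hu hupos hu₁cont hu₁pos heq vn hvn hv x _ (hδ m)
  have ta : Tendsto a atTop (𝓝 0) :=
    squeeze_zero (fun m => (ha0 m).le) (fun m => (haδ m).le) tδ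
  have ne : ∀ᵐ y : EuclideanSpace ℝ (Fin n), y ≠ x := by
    have : Nontrivial (EuclideanSpace ℝ (Fin n)) := by
      apply Module.nontrivial_of_finrank_pos (R := ℝ)
      simp; omega
    have := (measure_singleton (μ := (volume : Measure (EuclideanSpace ℝ (Fin n)))) x)
    exact compl_mem_ae_iff.2 this
  have lim : ∀ y, y ≠ x → Tendsto (fun m => ENNReal.ofReal (u₁ y * φ m y)) atTop
      (𝓝 (ENNReal.ofReal (u₁ y / ‖x - y‖ ^ ((n : ℝ) - 2)))) := by
    intro y hy
    have hpos : 0 < ‖x - y‖ := norm_pos_iff.2 (sub_ne_zero.2 hy.symm)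
    apply ENNReal.tendsto_ofReal
    rw [div_eq_mul_inv]
    apply Tendsto.const_mul
    have e : (‖x - y‖ ^ ((n : ℝ) - 2))⁻¹ = (‖x - y‖ ^ 2 + 0) ^ (-((n:ℝ)/2 - 1)) := by
      rw [add_zero, ← Real.rpow_natCast _ 2, ← Real.rpow_mul hpos.le, ← Real.rpow_neg hpos.le]
      congr 1; push_cast; ring
    rw [e]
    have tw : Tendsto (fun m => (‖x - y‖ ^ 2 + a m) ^ (-((n:ℝ)/2 - 1))) atTop
        (𝓝 ((‖x - y‖ ^ 2 + 0) ^ (-((n:ℝ)/2 - 1)))) :=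
      (ta.const_add _).rpow_const (Or.inl (by positivity))
    have tw2 := tw.sub (tδ.const_mul 2)
    rw [mul_zero, sub_zero] at tw2
    exact tendsto_of_tendsto_of_tendsto_of_le_of_le tw2 tw (fun m => φl m y) (fun m => φu m y)
  have main : ∫⁻ y, ENNReal.ofReal (u₁ y / ‖x - y‖ ^ ((n : ℝ) - 2)) ∂volume ≤
      ENNReal.ofReal (n * (n - 2) * (vn * u x)) := by
    calc ∫⁻ y, ENNReal.ofReal (u₁ y / ‖x - y‖ ^ ((n : ℝ) - 2)) ∂volume
        = ∫⁻ y, liminf (fun m => ENNReal.ofReal (u₁ y * φ m y)) atTop := by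
          apply lintegral_congr_ae
          filter_upwards [ne] with y hy
          exact (lim y hy).liminf_eq.symm
      _ ≤ liminf (fun m => ∫⁻ y, ENNReal.ofReal (u₁ y * φ m y)) atTop := by
          apply lintegral_liminf_le
          intro m
          exact (hu₁cont.mul (φc m)).measurable.ennreal_ofReal
      _ ≤ liminf (fun m : ℕ => ENNReal.ofReal (n * (n - 2) * (vn * u x + 1 / ((m:ℝ) + 1)))) atTop :=
          liminf_le_liminf (Eventually.of_forall φI)
      _ = _ := by
          apply Tendsto.liminf_eq
          apply ENNReal.tendsto_ofReal
          apply Tendsto.const_mul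
          simpa using tδ.const_add (vn * u x)
  calc _ ≤ ENNReal.ofReal (1 / (n * (n - 2) * vn)) * ENNReal.ofReal (n * (n - 2) * (vn * u x)) := by
        gcongr
    _ = ENNReal.ofReal (u x) := by
        rw [← ENNReal.ofReal_mul (by positivity)]
        congr 1
        have : (n:ℝ) - 2 ≠ 0 := by linarith
        have : (n:ℝ) ≠ 0 := by linarith
        field_simp
end

section
/- Let n ≥ 3 and let u : ℝⁿ → ℝ be a nonnegative C² function with −Δu = u₁ in ℝⁿ for a continuous nonnegative u₁, and suppose lim_{|x|→∞} u(x) = 0. Then u(x) = c_n ∫_{ℝⁿ} u₁(y)/|x−y|^{n−2} dy for all x, where c_n = 1/(n(n−2)v_n). -/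
open MeasureTheory Metric Filter

/-- Truncated paraboloid. -/
noncomputable def npPhi {n : ℕ} (y : EuclideanSpace ℝ (Fin n)) : ℝ := max 0 (1 - ‖y‖ ^ 2)

lemma npPhi_cont {n : ℕ} : Continuous (npPhi (n := n)) := by
  unfold npPhi; fun_prop

lemma npPhi_nonneg {n : ℕ} (y : EuclideanSpace ℝ (Fin n)) : 0 ≤ npPhi y := le_max_left _ _

lemma npPhi_zero {n : ℕ} (y : EuclideanSpace ℝ (Fin n)) (hy : 1 < ‖y‖) : npPhi y = 0 := by
  unfold npPhi
  apply max_eq_left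
  nlinarith

lemma npPhi_int {n : ℕ} (g : EuclideanSpace ℝ (Fin n) → ℝ) (hg : Continuous g) :
    Integrable (fun y => g y * npPhi y) := by
  apply (hg.mul npPhi_cont).integrable_of_hasCompactSupport
  apply HasCompactSupport.of_support_subset_isCompact (isCompact_closedBall 0 1)
  intro y hy
  by_contra h
  apply hy
  simp only [mem_closedBall, dist_zero_right, not_le] at h
  simp [npPhi_zero y h]

lemma np_sq_deriv (s : ℝ) : HasDerivAt (fun s : ℝ => (max 0 s) ^ 2) (2 * max 0 s) s := by
  rcases lt_trichotomy s 0 with h | h | h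
  · rw [max_eq_left h.le, mul_zero]
    apply (hasDerivAt_const s (0 : ℝ)).congr_of_eventuallyEq
    filter_upwards [Iio_mem_nhds h] with t ht
    rw [max_eq_left (le_of_lt ht)]; simp
  · subst h
    simp only [max_self, mul_zero]
    rw [hasDerivAt_iff_isLittleO]
    have h1 : (fun t : ℝ => (max 0 t) ^ 2 - (max 0 (0:ℝ)) ^ 2 - (t - 0) • (0:ℝ))
        =O[nhds 0] fun t => t ^ 2 := by
      apply Asymptotics.IsBigO.of_bound 1
      filter_upwards with t
      simp only [max_self, smul_zero, sub_zero, norm_pow, one_mul]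
      simp only [ne_eq, OfNat.ofNat_ne_zero, not_false_eq_true, zero_pow, sub_zero, norm_pow]
      gcongr
      rw [Real.norm_eq_abs, Real.norm_eq_abs, abs_of_nonneg (le_max_left _ _)]
      exact max_le (abs_nonneg _) (le_abs_self _)
    have h2 : (fun t : ℝ => t ^ 2) =o[nhds 0] fun t => t - 0 := by
      simpa using Asymptotics.isLittleO_pow_id (𝕜 := ℝ) (n := 2) (by norm_num)
    exact h1.trans_isLittleO h2
  · rw [max_eq_right h.le]
    have := (hasDerivAt_pow 2 s)
    simp only [Nat.cast_ofNat, Nat.add_one_sub_one, pow_one] at this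
    apply this.congr_of_eventuallyEq
    filter_upwards [Ioi_mem_nhds h] with t ht
    rw [max_eq_right (le_of_lt ht)]

lemma npPsi_fderiv {n : ℕ} (y : EuclideanSpace ℝ (Fin n)) :
    HasFDerivAt (fun y : EuclideanSpace ℝ (Fin n) => npPhi y ^ 2)
      ((-(4 * npPhi y)) • innerSL ℝ y) y := by
  have h1 : HasFDerivAt (fun y : EuclideanSpace ℝ (Fin n) => 1 - ‖y‖ ^ 2)
      (-(2 • innerSL ℝ y)) y := by
    simpa using ((hasStrictFDerivAt_norm_sq y).hasFDerivAt.const_sub 1)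
  have := (np_sq_deriv (1 - ‖y‖ ^ 2)).comp_hasFDerivAt y h1
  refine this.congr_fderiv ?_
  ext v
  simp [npPhi]
  ring

/-- derivative of the radial average -/
lemma npA_deriv {n : ℕ} (u : EuclideanSpace ℝ (Fin n) → ℝ)
    (hu : ContDiff ℝ 2 u) (x : EuclideanSpace ℝ (Fin n)) (t : ℝ) :
    HasDerivAt (fun t : ℝ => ∫ y, u (x + t • y) * npPhi y)
      (∫ y, fderiv ℝ u (x + t • y) y * npPhi y) t := by
  have hc : Continuous (fderiv ℝ u) := hu.continuous_fderiv (by norm_num)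
  have huc : Continuous u := hu.continuous
  obtain ⟨C, hC⟩ := (isCompact_closedBall x (|t| + 1)).exists_bound_of_continuousOn hc.continuousOn
  have hC0 : 0 ≤ C := (norm_nonneg _).trans (hC x (by simp; positivity))
  refine (hasDerivAt_integral_of_dominated_loc_of_deriv_le (μ := volume)
    (F := fun t y => u (x + t • y) * npPhi y)
    (F' := fun t y => fderiv ℝ u (x + t • y) y * npPhi y)
    (bound := fun y => C * npPhi y) (ball_mem_nhds t one_pos) ?_ ?_ ?_ ?_ ?_ ?_).2
  · filter_upwards with s
    exact (npPhi_int _ (by fun_prop)).aestronglyMeasurable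
  · exact npPhi_int _ (by fun_prop)
  · exact (npPhi_int _ (by fun_prop)).aestronglyMeasurable
  · filter_upwards with y s hs
    rw [norm_mul, Real.norm_of_nonneg (npPhi_nonneg y)]
    by_cases hy : 1 < ‖y‖
    · simp [npPhi_zero y hy]
    · push Not at hy
      have hs' : |s| ≤ |t| + 1 := by
        rw [mem_ball, Real.dist_eq] at hs
        have := abs_sub_abs_le_abs_sub s t
        linarith
      apply mul_le_mul_of_nonneg_right _ (npPhi_nonneg y)
      calc _ ≤ ‖fderiv ℝ u (x + s • y)‖ * ‖y‖ := ContinuousLinearMap.le_opNorm _ _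
        _ ≤ C * 1 := by
          apply mul_le_mul (hC _ _) hy (norm_nonneg _) hC0
          rw [mem_closedBall, dist_eq_norm, add_sub_cancel_left, norm_smul, Real.norm_eq_abs]
          calc |s| * ‖y‖ ≤ |s| * 1 := by gcongr
            _ ≤ _ := by linarith
        _ = C := mul_one C
  · exact npPhi_int _ continuous_const
  · filter_upwards with y s hs
    apply HasDerivAt.mul_const
    have h1 : HasDerivAt (fun s : ℝ => x + s • y) y s := by
      simpa using ((hasDerivAt_id s).smul_const y).const_add x
    exact ((hu.differentiable (by norm_num)) (x + s • y)).hasFDerivAt.comp_hasDerivAt s h1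

/-- integration by parts -/
lemma npA_parts {n : ℕ} (u u₁ : EuclideanSpace ℝ (Fin n) → ℝ)
    (hu : ContDiff ℝ 2 u) (heq : ∀ x, -(lap u x) = u₁ x)
    (x : EuclideanSpace ℝ (Fin n)) (t : ℝ) :
    ∫ y, fderiv ℝ u (x + t • y) y * npPhi y
      = - ∫ y, t * u₁ (x + t • y) * (npPhi y ^ 2 / 4) := by
  have hd1 : ContDiff ℝ 1 (fderiv ℝ u) := hu.fderiv_right (by norm_num)
  have hc : Continuous (fderiv ℝ u) := hd1.continuous
  have hc2 : Continuous (fderiv ℝ (fderiv ℝ u)) := hd1.continuous_fderiv (by norm_num)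
  have hdf : Differentiable ℝ (fderiv ℝ u) := hd1.differentiable (by norm_num)
  have hphic := npPhi_cont (n := n)
  let e : Fin n → EuclideanSpace ℝ (Fin n) := fun i => EuclideanSpace.single i 1
  have key : ∀ i, ∫ y, fderiv ℝ u (x + t • y) (e i) * (y i) * npPhi y =
      ∫ y, t * (fderiv ℝ (fderiv ℝ u) (x + t • y) (e i) (e i)) * npPhi y / 4 * npPhi y := by
    intro i
    have hf : ∀ y, HasFDerivAt (fun y => fderiv ℝ u (x + t • y) (e i))
        (t • (fderiv ℝ (fderiv ℝ u) (x + t • y)).flip (e i)) y := by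
      intro y
      have h1 : HasFDerivAt (fun y : EuclideanSpace ℝ (Fin n) => x + t • y)
          (t • ContinuousLinearMap.id ℝ _) y :=
        ((hasFDerivAt_id y).const_smul t).const_add x
      have h2 := ((hdf (x + t • y)).hasFDerivAt.comp y h1)
      have h3 := h2.clm_apply (hasFDerivAt_const (e i) y)
      refine h3.congr_fderiv ?_
      ext v
      simp
    have hg : ∀ y : EuclideanSpace ℝ (Fin n), HasFDerivAt (fun y => npPhi y ^ 2)
      ((-(4 * npPhi y)) • innerSL ℝ y) y := npPsi_fderiv
    have hgi : ∀ y : EuclideanSpace ℝ (Fin n),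
        fderiv ℝ (fun y => npPhi y ^ 2) y (e i) = -4 * y i * npPhi y := by
      intro y
      rw [(hg y).fderiv]
      simp [e, EuclideanSpace.inner_single_right]
      ring
    have hfi : ∀ y, fderiv ℝ (fun y => fderiv ℝ u (x + t • y) (e i)) y (e i)
        = t * (fderiv ℝ (fderiv ℝ u) (x + t • y) (e i) (e i)) := by
      intro y
      rw [(hf y).fderiv]
      simp
    have ibp := integral_mul_fderiv_eq_neg_fderiv_mul_of_integrable
      (μ := (volume : Measure (EuclideanSpace ℝ (Fin n))))
      (f := fun y => fderiv ℝ u (x + t • y) (e i)) (g := fun y => npPhi y ^ 2) (v := e i)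
      ?_ ?_ ?_ (fun y _ => (hf y).differentiableAt) (fun y _ => (hg y).differentiableAt)
    · simp only [hgi, hfi] at ibp
      have e1 : ∀ y, fderiv ℝ u (x + t • y) (e i) * (y i) * npPhi y =
        (-1/4) * (fderiv ℝ u (x + t • y) (e i) * (-4 * y i * npPhi y)) := by intro y; ring
      have e2 : ∀ y, t * (fderiv ℝ (fderiv ℝ u) (x + t • y) (e i) (e i)) * npPhi y / 4 * npPhi y
        = (1/4) * (t * (fderiv ℝ (fderiv ℝ u) (x + t • y) (e i) (e i)) * npPhi y ^ 2) := by
        intro y; ring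
      simp only [e1, e2, integral_const_mul, ibp]
      ring
    · simp only [hfi]
      simp only [pow_two, ← mul_assoc]
      exact npPhi_int _ (by fun_prop)
    · simp only [hgi]
      simp only [← mul_assoc]
      exact npPhi_int _ (by fun_prop)
    · simp only [pow_two, ← mul_assoc]
      exact npPhi_int _ (by fun_prop)
  have hsum : ∀ y : EuclideanSpace ℝ (Fin n), y = ∑ i, y i • e i := by
    intro y
    have := (EuclideanSpace.basisFun (Fin n) ℝ).sum_repr y
    simpa [e] using this.symm
  have l1 : ∀ y, fderiv ℝ u (x + t • y) y * npPhi y =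
      ∑ i, fderiv ℝ u (x + t • y) (e i) * (y i) * npPhi y := by
    intro y
    rw [← Finset.sum_mul]
    congr 1
    conv_lhs => arg 2; rw [hsum y]
    rw [map_sum]
    simp [mul_comm]
  have l2 : ∀ y, t * u₁ (x + t • y) * (npPhi y ^ 2 / 4) =
     - ∑ i, t * (fderiv ℝ (fderiv ℝ u) (x + t • y) (e i) (e i)) * npPhi y / 4 * npPhi y := by
    intro y
    rw [← heq]
    simp only [lap, iteratedFDeriv_two_apply, ← Finset.sum_mul, ← Finset.mul_sum,
      ← Finset.sum_div]
    simp [e]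
    ring
  simp only [l1, l2, integral_neg, neg_neg]
  rw [integral_finsetSum, integral_finsetSum]
  · exact Finset.sum_congr rfl fun i _ => key i
  · intro i _
    exact npPhi_int _ (by fun_prop)
  · intro i _
    exact npPhi_int _ (by fun_prop)

lemma npA_lim {n : ℕ} (hn : 3 ≤ n) (u : EuclideanSpace ℝ (Fin n) → ℝ) (hu : Continuous u)
    (hvanish : Tendsto u (cocompact (EuclideanSpace ℝ (Fin n))) (nhds 0))
    (x : EuclideanSpace ℝ (Fin n)) :
    Tendsto (fun t : ℝ => ∫ y, u (x + t • y) * npPhi y) atTop (nhds 0) := by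
  have : Nonempty (Fin n) := ⟨⟨0, by omega⟩⟩
  have hphic := npPhi_cont (n := n)
  let U : ZeroAtInftyContinuousMap (EuclideanSpace ℝ (Fin n)) ℝ := ⟨⟨u, hu⟩, hvanish⟩
  have hb : ∀ z, ‖u z‖ ≤ ‖U.toBCF‖ := fun z => U.toBCF.norm_coe_le_norm z
  have h0 : (0 : ℝ) = ∫ y : EuclideanSpace ℝ (Fin n), (0 : ℝ) := by simp
  rw [h0]
  apply tendsto_integral_filter_of_dominated_convergence (fun y => ‖U.toBCF‖ * npPhi y)
  · filter_upwards with t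
    exact (npPhi_int _ (by fun_prop)).aestronglyMeasurable
  · filter_upwards with t
    filter_upwards with y
    rw [norm_mul, Real.norm_of_nonneg (npPhi_nonneg y)]
    exact mul_le_mul_of_nonneg_right (hb _) (npPhi_nonneg y)
  · exact npPhi_int _ continuous_const
  · have : ∀ᵐ y : EuclideanSpace ℝ (Fin n), y ≠ 0 := by
      simp [ae_iff]
    filter_upwards [this] with y hy
    rw [← zero_mul (npPhi y)]
    apply Tendsto.mul_const
    apply hvanish.comp
    rw [← cobounded_eq_cocompact, ← tendsto_norm_atTop_iff_cobounded]
    have h1 : Tendsto (fun t : ℝ => t * ‖y‖ - ‖x‖) atTop atTop :=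
      tendsto_atTop_add_const_right _ _ (tendsto_id.atTop_mul_const (norm_pos_iff.2 hy))
    apply tendsto_atTop_mono' _ _ h1
    filter_upwards [eventually_ge_atTop 0] with t ht
    have := norm_sub_norm_le (t • y) (-x)
    rw [norm_smul, norm_neg, Real.norm_of_nonneg ht, sub_neg_eq_add, add_comm (t • y)] at this
    exact this

lemma np_phi_integral (m : ℕ) :
    ∫ y : EuclideanSpace ℝ (Fin (m + 3)), npPhi y =
      (volume (ball (0 : EuclideanSpace ℝ (Fin (m + 3))) 1)).toReal * (2 / (m + 5)) := by
  have h := integral_fun_norm_addHaar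
    (volume : Measure (EuclideanSpace ℝ (Fin (m + 3)))) (fun r => max 0 (1 - r ^ 2))
  have h1 : ∫ r in Set.Ioi (0 : ℝ), r ^ (m + 2) • max 0 (1 - r ^ 2) =
      (2 / ((m + 3) * (m + 5)) : ℝ) := by
    have : ∫ r in Set.Ioi (0 : ℝ), r ^ (m + 2) • max 0 (1 - r ^ 2) =
        ∫ r in Set.Ioc (0 : ℝ) 1, (r ^ (m + 2) - r ^ (m + 4)) := by
      rw [← integral_indicator measurableSet_Ioi, ← integral_indicator measurableSet_Ioc]
      congr 1
      ext r
      by_cases h0 : 0 < r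
      · by_cases h1 : r ≤ 1
        · rw [Set.indicator_of_mem (by exact h0), Set.indicator_of_mem (by exact ⟨h0, h1⟩),
            max_eq_right (by nlinarith), smul_eq_mul]
          ring
        · rw [Set.indicator_of_mem (by exact h0), Set.indicator_of_notMem (fun h => h1 h.2),
            max_eq_left (by nlinarith), smul_zero]
      · rw [Set.indicator_of_notMem (by exact h0), Set.indicator_of_notMem (fun h => h0 h.1)]
    rw [this, ← intervalIntegral.integral_of_le zero_le_one, intervalIntegral.integral_sub
      (Continuous.intervalIntegrable (by fun_prop) _ _)
      (Continuous.intervalIntegrable (by fun_prop) _ _), integral_pow, integral_pow]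
    simp
    field_simp
    ring
  simp only [finrank_euclideanSpace, Fintype.card_fin] at h
  rw [show m + 3 - 1 = m + 2 from rfl, h1] at h
  simp only [npPhi]
  rw [h, Measure.real]
  simp
  field_simp

lemma np_inner (m : ℕ) (z : EuclideanSpace ℝ (Fin (m + 3))) (hz : z ≠ 0) :
    ∫⁻ t in Set.Ioi (0 : ℝ),
      ENNReal.ofReal (t * (t ^ (m + 3))⁻¹ * (npPhi (t⁻¹ • z) ^ 2 / 4)) =
    ENNReal.ofReal (2 / ((m + 1) * (m + 3) * (m + 5)) / ‖z‖ ^ (m + 1)) := by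
  have hr : 0 < ‖z‖ := norm_pos_iff.2 hz
  set r := ‖z‖ with hrdef
  let g : ℝ → ℝ := fun t => (t ^ (m + 2))⁻¹ * ((1 - r ^ 2 / t ^ 2) ^ 2 / 4)
  let G : ℝ → ℝ := fun t => -(1 / 4) * ((m + 1 : ℝ)⁻¹ * (t⁻¹) ^ (m + 1)
    - 2 * r ^ 2 * (m + 3 : ℝ)⁻¹ * (t⁻¹) ^ (m + 3) + r ^ 4 * (m + 5 : ℝ)⁻¹ * (t⁻¹) ^ (m + 5))
  have hp : ∀ k : ℕ, ∀ t : ℝ, t ≠ 0 →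
      HasDerivAt (fun t : ℝ => (t⁻¹) ^ (k + 1)) (-(k + 1 : ℝ) * (t⁻¹) ^ (k + 2)) t := by
    intro k t ht
    have := (hasDerivAt_inv ht).pow (k + 1)
    refine this.congr_deriv ?_
    push_cast
    rw [pow_succ t⁻¹ (k + 1), pow_succ t⁻¹ k, ← inv_pow]
    ring
  have hder : ∀ t ∈ Set.Ici r, HasDerivAt G (g t) t := by
    intro t ht
    have ht0 : t ≠ 0 := (hr.trans_le ht).ne'
    have := ((((hp m t ht0).const_mul (m + 1 : ℝ)⁻¹).sub
      ((hp (m + 2) t ht0).const_mul (2 * r ^ 2 * (m + 3 : ℝ)⁻¹))).add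
      ((hp (m + 4) t ht0).const_mul (r ^ 4 * (m + 5 : ℝ)⁻¹))).const_mul (-(1 / 4) : ℝ)
    refine this.congr_deriv ?_
    simp only [g]
    push_cast
    have e1 : ((m : ℝ) + 2 + 1) = m + 3 := by ring
    have e2 : ((m : ℝ) + 4 + 1) = m + 5 := by ring
    rw [e1, e2]
    simp only [inv_pow]
    field_simp
    ring
  have hnn : ∀ t ∈ Set.Ioi r, 0 ≤ g t := by
    intro t ht
    have : 0 < t := hr.trans ht
    positivity
  have hlim : Tendsto G atTop (nhds 0) := by
    have h : ∀ k : ℕ, Tendsto (fun t : ℝ => (t⁻¹) ^ (k + 1)) atTop (nhds 0) := by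
      intro k
      simpa using (tendsto_inv_atTop_zero (𝕜 := ℝ)).pow (k + 1)
    have := ((((h m).const_mul (m + 1 : ℝ)⁻¹).sub
      ((h (m + 2)).const_mul (2 * r ^ 2 * (m + 3 : ℝ)⁻¹))).add
      ((h (m + 4)).const_mul (r ^ 4 * (m + 5 : ℝ)⁻¹))).const_mul (-(1 / 4) : ℝ)
    rw [show (-(1 / 4) : ℝ) * ((m + 1 : ℝ)⁻¹ * 0 - 2 * r ^ 2 * (m + 3 : ℝ)⁻¹ * 0 +
      r ^ 4 * (m + 5 : ℝ)⁻¹ * 0) = 0 by ring] at this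
    exact this
  have hI := integrableOn_Ioi_deriv_of_nonneg' hder hnn hlim
  have hval := integral_Ioi_of_hasDerivAt_of_nonneg' hder hnn hlim
  have hval2 : ∫ t in Set.Ioi r, g t = 2 / ((m + 1) * (m + 3) * (m + 5)) / r ^ (m + 1) := by
    rw [hval]
    simp only [G, inv_pow]
    field_simp
    ring
  rw [← hval2, ofReal_integral_eq_lintegral_ofReal hI
    ((ae_restrict_iff' measurableSet_Ioi).2 (ae_of_all _ hnn)),
    ← lintegral_indicator measurableSet_Ioi, ← lintegral_indicator measurableSet_Ioi]
  congr 1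
  ext t
  by_cases h0 : 0 < t
  · have hnorm : ‖t⁻¹ • z‖ = r / t := by
      rw [norm_smul, norm_inv, Real.norm_of_nonneg h0.le]; field_simp; rfl
    by_cases h1 : r < t
    · rw [Set.indicator_of_mem (by exact h0), Set.indicator_of_mem (by exact h1)]
      congr 1
      have : r / t ≤ 1 := (div_le_one h0).2 h1.le
      have h3 : 0 ≤ r / t := by positivity
      simp only [g, npPhi, hnorm]
      rw [max_eq_right (by nlinarith)]
      field_simp
      ring
    · rw [Set.indicator_of_mem (by exact h0), Set.indicator_of_notMem (by exact h1)]
      have : 1 ≤ r / t := (one_le_div h0).2 (not_lt.1 h1)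
      simp only [npPhi, hnorm]
      rw [max_eq_left (by nlinarith)]
      simp
  · rw [Set.indicator_of_notMem (by exact h0),
      Set.indicator_of_notMem (fun h : t ∈ Set.Ioi r => h0 (hr.trans h))]

/-- if `u ≥ 0` is `C²` with `−Δu = u₁ ≥ 0` continuous and `u → 0` at infinity,
then `u` equals the Newtonian potential of `u₁`:
`u(x) = c_n ∫ u₁(y)/|x−y|^{n−2} dy` with `c_n = 1/(n(n−2)v_n)`. -/
theorem newtonian_potential_eq {n : ℕ} (hn : 3 ≤ n)
    (u u₁ : EuclideanSpace ℝ (Fin n) → ℝ)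
    (hu : ContDiff ℝ 2 u) (hupos : ∀ x, 0 ≤ u x)
    (hu₁cont : Continuous u₁) (hu₁pos : ∀ x, 0 ≤ u₁ x)
    (heq : ∀ x, -(lap u x) = u₁ x)
    (hvanish : Tendsto u (cocompact (EuclideanSpace ℝ (Fin n))) (nhds 0))
    (vn : ℝ) (hvn : vn = (volume (ball (0 : EuclideanSpace ℝ (Fin n)) 1)).toReal) :
    ∀ x, u x = (1 / (n * (n - 2) * vn)) *
        ∫ y, u₁ y / ‖x - y‖ ^ ((n : ℝ) - 2) ∂volume := by
  intro x
  obtain ⟨m, rfl⟩ : ∃ m, n = m + 3 := ⟨n - 3, by omega⟩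
  have hphic := npPhi_cont (n := m + 3)
  have hphim := hphic.measurable
  have hu₁m := hu₁cont.measurable
  have hvpos : 0 < vn := by
    rw [hvn]
    exact ENNReal.toReal_pos (measure_ball_pos _ _ one_pos).ne' measure_ball_lt_top.ne
  set I : ℝ := ∫ y, u₁ y / ‖x - y‖ ^ (((m + 3 : ℕ) : ℝ) - 2) ∂volume with hIdef
  let c : ℝ := 2 / ((m + 1) * (m + 3) * (m + 5))
  have hcpos : 0 < c := by positivity
  have hI : I = ∫ z, u₁ (x + z) / ‖z‖ ^ (m + 1) := by
    rw [hIdef, ← integral_add_left_eq_self _ x]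
    congr 1
    ext z
    rw [show (((m + 3 : ℕ) : ℝ) - 2) = ((m + 1 : ℕ) : ℝ) by push_cast; ring, Real.rpow_natCast]
    simp
  let B : ℝ → ℝ := fun t => ∫ y, t * u₁ (x + t • y) * (npPhi y ^ 2 / 4)
  have hder : ∀ t ∈ Set.Ici (0 : ℝ),
      HasDerivAt (fun t : ℝ => ∫ y, u (x + t • y) * npPhi y) (-B t) t := by
    intro t _
    have := npA_deriv u hu x t
    rwa [npA_parts u u₁ hu heq x t] at this
  have hBnn : ∀ t ∈ Set.Ioi (0 : ℝ), 0 ≤ B t := by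
    intro t ht
    apply integral_nonneg
    intro y
    have := hu₁pos (x + t • y)
    have ht' : (0 : ℝ) < t := ht
    have := npPhi_nonneg y
    simp only [Pi.zero_apply]
    positivity
  have hBnp : ∀ t ∈ Set.Ioi (0 : ℝ), -B t ≤ 0 := fun t ht => neg_nonpos.2 (hBnn t ht)
  have hlim := npA_lim hn u hu.continuous hvanish x
  have hBint : IntegrableOn B (Set.Ioi 0) := by
    simpa using (integrableOn_Ioi_deriv_of_nonpos' hder hBnp hlim).neg
  have hBval : ∫ t in Set.Ioi (0 : ℝ), B t = u x * (vn * (2 / (m + 5))) := by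
    have := integral_Ioi_of_hasDerivAt_of_nonpos' hder hBnp hlim
    rw [integral_neg] at this
    simp only [zero_smul, add_zero, integral_const_mul, np_phi_integral, ← hvn] at this
    linarith
  have hB2 : ∀ t ∈ Set.Ioi (0 : ℝ), ENNReal.ofReal (B t) = ∫⁻ z, ENNReal.ofReal (u₁ (x + z)) *
      ENNReal.ofReal (t * (t ^ (m + 3))⁻¹ * (npPhi (t⁻¹ • z) ^ 2 / 4)) := by
    intro t ht
    have ht' : (0 : ℝ) < t := ht
    have h1 : B t = (∫ z, u₁ (x + z) * (t * (t ^ (m + 3))⁻¹ * (npPhi (t⁻¹ • z) ^ 2 / 4))) := by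
      have := Measure.integral_comp_smul (volume : Measure (EuclideanSpace ℝ (Fin (m + 3))))
        (fun z => t * u₁ (x + z) * (npPhi (t⁻¹ • z) ^ 2 / 4)) t
      simp only [smul_smul, inv_mul_cancel₀ ht'.ne', one_smul, finrank_euclideanSpace,
        Fintype.card_fin] at this
      simp only [B]
      rw [this, abs_of_pos (by positivity), smul_eq_mul, ← integral_const_mul]
      congr 1
      ext z
      ring
    rw [h1, ofReal_integral_eq_lintegral_ofReal]
    · congr 1
      ext z
      rw [ENNReal.ofReal_mul (hu₁pos _)]
    · apply Continuous.integrable_of_hasCompactSupport (by fun_prop)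
      apply HasCompactSupport.of_support_subset_isCompact (isCompact_closedBall 0 t)
      intro z hz
      by_contra h
      apply hz
      simp only [mem_closedBall, dist_zero_right, not_le] at h
      have : npPhi (t⁻¹ • z) = 0 := by
        apply npPhi_zero
        rw [norm_smul, norm_inv, Real.norm_of_nonneg ht'.le, inv_mul_eq_div]
        exact (one_lt_div ht').2 h
      simp [this]
    · filter_upwards with z
      have := hu₁pos (x + z)
      have := npPhi_nonneg (t⁻¹ • z)
      simp only [Pi.zero_apply]
      positivity
  have hmain : ENNReal.ofReal (u x * (vn * (2 / (m + 5)))) =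
      ∫⁻ z, ENNReal.ofReal (c * (u₁ (x + z) / ‖z‖ ^ (m + 1))) := by
    rw [← hBval, ofReal_integral_eq_lintegral_ofReal hBint
      ((ae_restrict_iff' measurableSet_Ioi).2 (ae_of_all _ hBnn)),
      setLIntegral_congr_fun measurableSet_Ioi hB2, lintegral_lintegral_swap]
    · have : ∀ᵐ z : EuclideanSpace ℝ (Fin (m + 3)), z ≠ 0 := by simp [ae_iff]
      apply lintegral_congr_ae
      filter_upwards [this] with z hz
      rw [lintegral_const_mul' _ _ ENNReal.ofReal_ne_top, np_inner m z hz,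
        ← ENNReal.ofReal_mul (hu₁pos _)]
      congr 1
      simp only [c]
      ring
    · apply Measurable.aemeasurable
      unfold Function.uncurry
      fun_prop
  have hfin : c * I = u x * (vn * (2 / (m + 5))) := by
    rw [hI, ← integral_const_mul, integral_eq_lintegral_of_nonneg_ae, ← hmain,
      ENNReal.toReal_ofReal]
    · have := hupos x
      positivity
    · filter_upwards with z
      have := hu₁pos (x + z)
      simp only [Pi.zero_apply]
      positivity
    · apply Measurable.aestronglyMeasurable
      fun_prop
  simp only [c] at hfin
  push_cast
  rw [show (m : ℝ) + 3 - 2 = m + 1 by ring]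
  field_simp at hfin ⊢
  linarith
end
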